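/- There exists a constant c such that for every positive integer n there is a decision tree of height at most c·n that finds all runs in strings of length n (over an arbitrary linearly ordered alphabet). -/

import Mathlib

/-- `p` is a period of the substring `t[i..j]` of the 1-indexed string `t`:
`1 ≤ p ≤ |t[i..j]| = j - i + 1`, and `t[k] = t[k + p]` whenever both positions
lie in `[i..j]` (vacuously, the length is always a period). -/
def IsPeriodOf {α : Type*} (t : ℕ → α) (i j p : ℕ) : Prop :=
  1 ≤ p ∧ p ≤ j + 1 - i ∧ ∀ k, i ≤ k → k + p ≤ j → t (k + p) = t k

/-- The minimal period of the substring `t[i..j]`. -/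
noncomputable def minPeriod {α : Type*} (t : ℕ → α) (i j : ℕ) : ℕ :=
  sInf {p | IsPeriodOf t i j p}

/-- `t[i..j]` is a run of the string `t[1..n]`: its exponent is at least `2`
(i.e. `j - i + 1 ≥ 2 · minPeriod`), and the extensions `t[i-1..j]` (if `i > 1`)
and `t[i..j+1]` (if `j < n`) have strictly larger minimal periods. -/
def IsRun {α : Type*} (t : ℕ → α) (n i j : ℕ) : Prop :=
  1 ≤ i ∧ i ≤ j ∧ j ≤ n ∧
  2 * minPeriod t i j ≤ j + 1 - i ∧
  (1 < i → minPeriod t i j < minPeriod t (i - 1) j) ∧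
  (j < n → minPeriod t i j < minPeriod t i (j + 1))

/-- A decision tree processing strings of length `n`: every internal node is
labeled with a pair `(i, j)` of positions and has three children corresponding
to the outcomes `t[i] < t[j]`, `t[i] = t[j]`, `t[i] > t[j]`. -/
inductive DecisionTree : Type where
  | leaf : DecisionTree
  | node (i j : ℕ) (lt eq gt : DecisionTree) : DecisionTree

namespace DecisionTree

/-- All node labels `(i, j)` satisfy `1 ≤ i, j ≤ n`. -/
def WF (n : ℕ) : DecisionTree → Prop
  | .leaf => True
  | .node i j l e g => 1 ≤ i ∧ i ≤ n ∧ 1 ≤ j ∧ j ≤ n ∧ WF n l ∧ WF n e ∧ WF n g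

/-- The computation path of the string `t` through the tree, recorded as the
list of edge labels; it uniquely identifies the leaf reached by `t`
(two strings reach the same leaf iff their paths are equal). -/
def path {α : Type*} [LinearOrder α] : DecisionTree → (ℕ → α) → List Ordering
  | .leaf, _ => []
  | .node i j l e g, t =>
    if t i < t j then Ordering.lt :: path l t
    else if t i = t j then Ordering.eq :: path e t
    else Ordering.gt :: path g t

/-- The height of a decision tree: the maximum number of edges on a
root-to-leaf path. -/
def height : DecisionTree → ℕ
  | .leaf => 0
  | .node _ _ l e g => 1 + max (height l) (max (height e) (height g))

/-- The basic height of a decision tree: the maximum, over root-to-leaf paths,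
of the number of edges labeled `<` or `>`. -/
def basicHeight : DecisionTree → ℕ
  | .leaf => 0
  | .node _ _ l e g =>
    max (1 + max (basicHeight l) (basicHeight g)) (basicHeight e)

end DecisionTree

/-- The decision tree `T` finds all runs in strings of length `n`: for any two
strings (over any linearly ordered alphabet) reaching the same leaf, the runs
occur at exactly the same pairs of positions. -/
def FindsAllRuns (n : ℕ) (T : DecisionTree) : Prop :=
  ∀ (α : Type) [LinearOrder α] (t₁ t₂ : ℕ → α),
    T.path t₁ = T.path t₂ → ∀ i j, (IsRun t₁ n i j ↔ IsRun t₂ n i j)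

/-! ## Adaptive solvability with mismatch-counting cost -/

/-- `Solv F S k`: there is an adaptive strategy of comparisons determining `F w` for
`w ∈ S`, receiving at most `k w` unequal answers on `w`. -/
inductive Solv {β : Type} (F : (ℕ → ℕ) → β) : Set (ℕ → ℕ) → ((ℕ → ℕ) → ℕ) → Prop
  | done (S : Set (ℕ → ℕ)) (k : (ℕ → ℕ) → ℕ)
      (h : ∀ w ∈ S, ∀ w' ∈ S, F w = F w') : Solv F S k
  | ask (S : Set (ℕ → ℕ)) (k : (ℕ → ℕ) → ℕ) (i j : ℕ)
      (hk : ∀ w ∈ S, w i ≠ w j → 1 ≤ k w)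
      (heq : Solv F {w | w ∈ S ∧ w i = w j} k)
      (hlt : Solv F {w | w ∈ S ∧ w i < w j} (fun w => k w - 1))
      (hgt : Solv F {w | w ∈ S ∧ w j < w i} (fun w => k w - 1)) : Solv F S k

namespace Solv

variable {β γ : Type} {F : (ℕ → ℕ) → β} {G : (ℕ → ℕ) → γ}
  {S S' : Set (ℕ → ℕ)} {k k' : (ℕ → ℕ) → ℕ}

theorem mono (h : Solv F S k) : ∀ {S' : Set (ℕ → ℕ)} {k' : (ℕ → ℕ) → ℕ}, S' ⊆ S →
    (∀ w ∈ S', k w ≤ k' w) → Solv F S' k' := by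
  induction h with
  | done S k h => 
    intro S' k' hS _
    exact done _ _ fun w hw w' hw' => h w (hS hw) w' (hS hw')
  | ask S k i j hk _ _ _ h1 h2 h3 =>
    intro S' k' hS hkk
    refine ask _ _ i j (fun w hw hne => (hk w (hS hw) hne).trans (hkk w hw)) 
      (h1 (fun w hw => ⟨hS hw.1, hw.2⟩) fun w hw => hkk w hw.1)
      (h2 (fun w hw => ⟨hS hw.1, hw.2⟩) fun w hw => ?_)
      (h3 (fun w hw => ⟨hS hw.1, hw.2⟩) fun w hw => ?_)
    · have := hkk w hw.1
      beta_reduce; omega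
    · have := hkk w hw.1
      beta_reduce; omega

theorem congr (h : Solv F S k) (hFG : ∀ w ∈ S, ∀ w' ∈ S, F w = F w' → G w = G w') :
    Solv G S k := by
  induction h with
  | done S k h => exact done _ _ fun w hw w' hw' => hFG _ hw _ hw' (h w hw w' hw')
  | ask S k i j hk _ _ _ h1 h2 h3 =>
    exact ask _ _ i j hk (h1 fun w hw w' hw' => hFG w hw.1 w' hw'.1)
      (h2 fun w hw w' hw' => hFG w hw.1 w' hw'.1) (h3 fun w hw w' hw' => hFG w hw.1 w' hw'.1)

theorem bind (h : Solv F S k) : (∀ b, Solv G {w | w ∈ S ∧ F w = b} k') →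
    Solv G S (fun w => k w + k' w) := by
  induction h with
  | done S k h => 
    intro hG
    by_cases hS : ∃ w0, w0 ∈ S
    · obtain ⟨w0, hw0⟩ := hS
      exact (hG (F w0)).mono (fun w hw => ⟨hw, h w hw w0 hw0⟩) (fun w _ => Nat.le_add_left _ _)
    · push Not at hS
      exact done _ _ fun w hw => absurd hw (hS w)
  | ask S k i j hk _ _ _ h1 h2 h3 =>
    intro hG
    refine ask _ _ i j (fun w hw hne => (hk w hw hne).trans (Nat.le_add_right _ _)) 
      (h1 fun b => (hG b).mono (fun w hw => ⟨hw.1.1, hw.2⟩) fun w _ => le_rfl)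
      ((h2 fun b => (hG b).mono (fun w hw => ⟨hw.1.1, hw.2⟩) fun w _ => le_rfl).mono
        (fun w hw => hw) fun w hw => ?_)
      ((h3 fun b => (hG b).mono (fun w hw => ⟨hw.1.1, hw.2⟩) fun w _ => le_rfl).mono
        (fun w hw => hw) fun w hw => ?_)
    · have := hk w hw.1 (by have := hw.2; omega)
      beta_reduce; omega
    · have := hk w hw.1 (by have := hw.2; omega)
      beta_reduce; omega

theorem prod (h : Solv F S k) (h' : Solv G S k') :
    Solv (fun w => (F w, G w)) S (fun w => k w + k' w) := by
  refine h.bind fun b => ?_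
  refine Solv.congr (h'.mono (fun w hw => hw.1) fun w _ => le_rfl) ?_
  intro w hw w' hw' e
  simp only [Prod.mk.injEq]
  exact ⟨hw.2.trans hw'.2.symm, e⟩

theorem all {f : ℕ → (ℕ → ℕ) → β} {c : ℕ} (N : ℕ)
    (h : ∀ i < N, Solv (f i) S (fun _ => c)) :
    Solv (fun w => (List.range N).map fun i => f i w) S (fun _ => c * N) := by
  induction N with
  | zero => exact done _ _ fun w _ w' _ => by simp
  | succ N ih =>
    have h1 := (ih fun i hi => h i (by omega)).prod (h N (by omega))
    refine (h1.congr (G := fun w => (List.range (N+1)).map fun i => f i w) ?_).mono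
      (fun w hw => hw) fun w _ => by simp [Nat.mul_succ]
    intro w _ w' _ e
    simp only [Prod.mk.injEq] at e
    simp only [List.range_succ, List.map_append, List.map_cons, List.map_nil, e.1, e.2]

theorem firstdiff (a b : ℕ → ℕ) (hk : ∀ w ∈ S, 1 ≤ k w) (N : ℕ)
    (hlt : ∀ l < N, Solv F {w | w ∈ S ∧ (∀ m < l, w (a m) = w (b m)) ∧ w (a l) < w (b l)}
      (fun w => k w - 1))
    (hgt : ∀ l < N, Solv F {w | w ∈ S ∧ (∀ m < l, w (a m) = w (b m)) ∧ w (b l) < w (a l)}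
      (fun w => k w - 1))
    (heq : Solv F {w | w ∈ S ∧ ∀ m < N, w (a m) = w (b m)} k) : Solv F S k := by
  induction N with
  | zero => exact heq.mono (fun w hw => ⟨hw, fun m hm => by omega⟩) fun w _ => le_rfl
  | succ N ih =>
    refine ih (fun l hl => hlt l (by omega)) (fun l hl => hgt l (by omega)) ?_
    refine ask _ _ (a N) (b N) (fun w hw _ => hk w hw.1) (heq.mono ?_ fun w _ => le_rfl)
      ((hlt N (by omega)).mono (fun w hw => ⟨hw.1.1, hw.1.2, hw.2⟩) fun w _ => le_rfl)
      ((hgt N (by omega)).mono (fun w hw => ⟨hw.1.1, hw.1.2, hw.2⟩) fun w _ => le_rfl)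
    intro w hw
    refine ⟨hw.1.1, fun m hm => ?_⟩
    rcases Nat.lt_succ_iff_lt_or_eq.mp hm with h | h
    · exact hw.1.2 m h
    · subst h; exact hw.2

/-- Finding the first mismatch costs one unequal answer. -/
theorem find (a b : ℕ → ℕ) (N : ℕ) (hN : ∀ w ∈ S, ∃ l < N, w (a l) ≠ w (b l)) :
    Solv (fun w => sInf {l | w (a l) ≠ w (b l)}) S (fun _ => 1) := by
  have key : ∀ l (w : ℕ → ℕ), (∀ m < l, w (a m) = w (b m)) → w (a l) ≠ w (b l) →
      sInf {l | w (a l) ≠ w (b l)} = l := by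
    intro l w h1 h2
    apply le_antisymm (Nat.sInf_le h2)
    by_contra hlt
    push Not at hlt
    exact (Nat.sInf_mem (⟨l, h2⟩ : Set.Nonempty {l | w (a l) ≠ w (b l)})) (h1 _ hlt)
  refine firstdiff a b (fun _ _ => le_rfl) N ?_ ?_ ?_
  · intro l _
    refine done _ _ fun w hw w' hw' => ?_
    rw [key l w hw.2.1 (by have := hw.2.2; omega), key l w' hw'.2.1 (by have := hw'.2.2; omega)]
  · intro l _
    refine done _ _ fun w hw w' hw' => ?_
    rw [key l w hw.2.1 (by have := hw.2.2; omega), key l w' hw'.2.1 (by have := hw'.2.2; omega)]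
  · refine done _ _ fun w hw => ?_
    obtain ⟨l, hl, hne⟩ := hN w hw.1
    exact absurd (hw.2 l hl) hne

end Solv

/-- Valid words: zero exactly outside `[1..n]`. -/
def VW (n : ℕ) : Set (ℕ → ℕ) := {w | ∀ k, w k = 0 ↔ (k = 0 ∨ n < k)}

/-- Order reversing relabeling. -/
def dualW (n : ℕ) (w : ℕ → ℕ) : ℕ → ℕ :=
  fun k => if w k = 0 then 0 else 1 + ((Finset.Icc 1 n).sup w - w k)

theorem VW.le_sup {n : ℕ} {w : ℕ → ℕ} (hw : w ∈ VW n) (k : ℕ) : w k ≤ (Finset.Icc 1 n).sup w := by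
  by_cases h : w k = 0
  · omega
  · apply Finset.le_sup (f := w)
    have := hw k
    simp only [Finset.mem_Icc]
    omega

theorem dualW_zero {n : ℕ} {w : ℕ → ℕ} (k : ℕ) : dualW n w k = 0 ↔ w k = 0 := by
  unfold dualW; split_ifs <;> omega

theorem dualW_mem {n : ℕ} {w : ℕ → ℕ} (hw : w ∈ VW n) : dualW n w ∈ VW n := by
  intro k
  rw [dualW_zero]; exact hw k

theorem dualW_eq {n : ℕ} {w : ℕ → ℕ} (hw : w ∈ VW n) (i j : ℕ) :
    dualW n w i = dualW n w j ↔ w i = w j := by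
  have h1 := VW.le_sup hw i
  have h2 := VW.le_sup hw j
  unfold dualW; split_ifs <;> omega

theorem dualW_lt {n : ℕ} {w : ℕ → ℕ} (hw : w ∈ VW n) (i j : ℕ) (hi : w i ≠ 0) (hj : w j ≠ 0) :
    dualW n w i < dualW n w j ↔ w j < w i := by
  have h1 := VW.le_sup hw i
  have h2 := VW.le_sup hw j
  unfold dualW; rw [if_neg hi, if_neg hj]; omega

theorem dualW_lt' {n : ℕ} {w : ℕ → ℕ} (_hw : w ∈ VW n) (i j : ℕ) (hi : w i = 0 ∨ w j = 0) :
    dualW n w i < dualW n w j ↔ w i < w j := by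
  unfold dualW; split_ifs <;> omega

theorem Solv.dual {β : Type} {F : (ℕ → ℕ) → β} {S : Set (ℕ → ℕ)} {k : (ℕ → ℕ) → ℕ} (n : ℕ)
    (h : Solv F S k) :
    Solv (fun w => F (dualW n w)) {w | w ∈ VW n ∧ dualW n w ∈ S} (fun w => k (dualW n w)) := by
  induction h with
  | done S k h => exact .done _ _ fun w hw w' hw' => h _ hw.2 _ hw'.2
  | ask S k i j hk _ _ _ h1 h2 h3 =>
    have hz : ∀ k, (∀ w ∈ VW n, w k = 0) ∨ (∀ w ∈ VW n, w k ≠ 0) := by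
      intro k
      by_cases h : k = 0 ∨ n < k
      · exact Or.inl fun w hw => (hw k).2 h
      · exact Or.inr fun w hw e => h ((hw k).1 e)
    have hh : (∀ w ∈ VW n, w i = 0 ∨ w j = 0) ∨ (∀ w ∈ VW n, w i ≠ 0 ∧ w j ≠ 0) := by
      rcases hz i with h | h
      · exact Or.inl fun w hw => Or.inl (h w hw)
      · rcases hz j with h' | h'
        · exact Or.inl fun w hw => Or.inr (h' w hw)
        · exact Or.inr fun w hw => ⟨h w hw, h' w hw⟩
    have e1 : Solv (fun w => F (dualW n w))
        {w | w ∈ {w | w ∈ VW n ∧ dualW n w ∈ S} ∧ w i = w j} (fun w => k (dualW n w)) :=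
      h1.mono (fun w hw => ⟨hw.1.1, hw.1.2, (dualW_eq hw.1.1 i j).2 hw.2⟩) fun w _ => le_rfl
    have e0 : ∀ w ∈ {w | w ∈ VW n ∧ dualW n w ∈ S}, w i ≠ w j → 1 ≤ k (dualW n w) :=
      fun w hw hne => hk _ hw.2 fun e => hne ((dualW_eq hw.1 i j).1 e)
    rcases hh with hh | hh
    · refine .ask _ _ i j e0 e1 
        (h2.mono (fun w hw => ⟨hw.1.1, hw.1.2, ?_⟩) fun w _ => le_rfl)
        (h3.mono (fun w hw => ⟨hw.1.1, hw.1.2, ?_⟩) fun w _ => le_rfl)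
      · exact (dualW_lt' hw.1.1 i j (hh w hw.1.1)).2 hw.2
      · exact (dualW_lt' hw.1.1 j i (hh w hw.1.1).symm).2 hw.2
    · refine .ask _ _ i j e0 e1
        (h3.mono (fun w hw => ⟨hw.1.1, hw.1.2, ?_⟩) fun w _ => le_rfl)
        (h2.mono (fun w hw => ⟨hw.1.1, hw.1.2, ?_⟩) fun w _ => le_rfl)
      · exact (dualW_lt hw.1.1 j i (hh w hw.1.1).2 (hh w hw.1.1).1).2 hw.2
      · exact (dualW_lt hw.1.1 i j (hh w hw.1.1).1 (hh w hw.1.1).2).2 hw.2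

/-! ## From strategies to decision trees -/

theorem card_merge (n : ℕ) (r : ℕ → ℕ) (i j : ℕ) (hi : i ∈ Finset.Icc 1 n)
    (hj : j ∈ Finset.Icc 1 n) (hr : r i ≠ r j) :
    ((Finset.Icc 1 n).image (fun k => if r k = r i then r j else r k)).card + 1
      ≤ ((Finset.Icc 1 n).image r).card := by
  have hsub : (Finset.Icc 1 n).image (fun k => if r k = r i then r j else r k) ⊆
      ((Finset.Icc 1 n).image r).erase (r i) := by
    intro x hx
    obtain ⟨k, hk, rfl⟩ := Finset.mem_image.1 hx
    simp only [Finset.mem_erase]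
    split_ifs with h
    · exact ⟨fun e => hr e.symm, Finset.mem_image_of_mem _ hj⟩
    · exact ⟨h, Finset.mem_image_of_mem _ hk⟩
  have := Finset.card_le_card hsub
  have h1 : r i ∈ (Finset.Icc 1 n).image r := Finset.mem_image_of_mem _ hi
  rw [Finset.card_erase_of_mem h1] at this
  have : 0 < ((Finset.Icc 1 n).image r).card := Finset.card_pos.2 ⟨_, h1⟩
  omega

theorem Solv.toTree {β : Type} {F : (ℕ → ℕ) → β} {S : Set (ℕ → ℕ)} {k : (ℕ → ℕ) → ℕ} (n : ℕ)
    (h : Solv F S k) : S ⊆ VW n → ∀ (r : ℕ → ℕ),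
    (∀ w ∈ S, ∀ i j, r i = r j → w i = w j) → ∀ N : ℕ,
    ∃ T : DecisionTree, T.WF n ∧ T.height ≤ N ∧ ∀ w ∈ S, ∀ w' ∈ S,
      k w + ((Finset.Icc 1 n).image r).card ≤ N → k w' + ((Finset.Icc 1 n).image r).card ≤ N →
      T.path w = T.path w' → F w = F w' := by
  induction h with
  | done S k h =>
    intro hS r hr N
    exact ⟨.leaf, trivial, Nat.zero_le _, fun w hw w' hw' _ _ _ => h w hw w' hw'⟩
  | ask S k i j hk _ _ _ h1 h2 h3 =>
    intro hS r hr N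
    by_cases hin : (1 ≤ i ∧ i ≤ n) ∧ (1 ≤ j ∧ j ≤ n)
    · by_cases hrij : r i = r j
      · obtain ⟨T, hT1, hT2, hT3⟩ := h1 (fun w hw => hS hw.1) r (fun w hw => hr w hw.1) N
        exact ⟨T, hT1, hT2, fun w hw w' hw' =>
          hT3 w ⟨hw, hr w hw _ _ hrij⟩ w' ⟨hw', hr w' hw' _ _ hrij⟩⟩
      · have hi : i ∈ Finset.Icc 1 n := by simp; omega
        have hj : j ∈ Finset.Icc 1 n := by simp; omega
        have hc := card_merge n r i j hi hj hrij
        rcases N with _ | N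
        · exact ⟨.leaf, trivial, Nat.zero_le _, fun w hw w' hw' h _ _ => by omega⟩
        · obtain ⟨T1, a1, a2, a3⟩ := h1 (fun w hw => hS hw.1) 
            (fun k => if r k = r i then r j else r k) (by
              intro w hw x y hxy
              have e := hw.2
              have := hr w hw.1
              split_ifs at hxy with u v v
              · exact this _ _ (u.trans v.symm)
              · rw [this _ _ u, e]; exact this _ _ hxy
              · rw [this _ _ v, e]; exact this _ _ hxy
              · exact this _ _ hxy) N
          obtain ⟨T2, b1, b2, b3⟩ := h2 (fun w hw => hS hw.1) r (fun w hw => hr w hw.1) N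
          obtain ⟨T3, c1, c2, c3⟩ := h3 (fun w hw => hS hw.1) r (fun w hw => hr w hw.1) N
          refine ⟨.node i j T2 T1 T3, ⟨hin.1.1, hin.1.2, hin.2.1, hin.2.2, b1, a1, c1⟩, ?_, ?_⟩
          · simp only [DecisionTree.height]; omega
          · intro w hw w' hw' hN hN' hp
            simp only [DecisionTree.path] at hp
            have q := hk w hw
            have q' := hk w' hw'
            split_ifs at hp with u1 u2 u3 u4 u5 u6 u7 u8 <;> simp at hp
            · exact b3 w ⟨hw, u1⟩ w' ⟨hw', u2⟩ (by beta_reduce; omega) (by beta_reduce; omega) hp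
            · exact a3 w ⟨hw, by assumption⟩ w' ⟨hw', by assumption⟩ (by omega) (by omega) hp
            · exact c3 w ⟨hw, by omega⟩ w' ⟨hw', by omega⟩ (by beta_reduce; omega) (by beta_reduce; omega) hp
    · -- out of range: the answer is known
      have hz : ∀ k, (∀ w ∈ S, w k = 0 ↔ (k = 0 ∨ n < k)) := fun k w hw => hS hw k
      by_cases hi : 1 ≤ i ∧ i ≤ n
      · obtain ⟨T, hT1, hT2, hT3⟩ := h3 (fun w hw => hS hw.1) r (fun w hw => hr w hw.1) N
        have hlt : ∀ w ∈ S, w j < w i := fun w hw => by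
          have a := hz i w hw
          have b := hz j w hw
          omega
        exact ⟨T, hT1, hT2, fun w hw w' hw' p p' => hT3 w ⟨hw, hlt w hw⟩ w' ⟨hw', hlt w' hw'⟩
          (by beta_reduce; omega) (by beta_reduce; omega)⟩
      · by_cases hj : 1 ≤ j ∧ j ≤ n
        · obtain ⟨T, hT1, hT2, hT3⟩ := h2 (fun w hw => hS hw.1) r (fun w hw => hr w hw.1) N
          have hlt : ∀ w ∈ S, w i < w j := fun w hw => by
            have a := hz i w hw
            have b := hz j w hw
            omega
          exact ⟨T, hT1, hT2, fun w hw w' hw' p p' => hT3 w ⟨hw, hlt w hw⟩ w' ⟨hw', hlt w' hw'⟩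
            (by beta_reduce; omega) (by beta_reduce; omega)⟩
        · obtain ⟨T, hT1, hT2, hT3⟩ := h1 (fun w hw => hS hw.1) r (fun w hw => hr w hw.1) N
          have hlt : ∀ w ∈ S, w i = w j := fun w hw => by
            have a := hz i w hw
            have b := hz j w hw
            omega
          exact ⟨T, hT1, hT2, fun w hw w' hw' p p' => hT3 w ⟨hw, hlt w hw⟩ w' ⟨hw', hlt w' hw'⟩
            p p'⟩

/-! ## Suffix order and next smaller suffixes -/

/-- The (infinite) suffix of `w` starting at `i`, with lexicographic order. -/
def sf (w : ℕ → ℕ) (i : ℕ) : Lex (ℕ → ℕ) := toLex fun m => w (i + m)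

theorem sf_lt_iff {w : ℕ → ℕ} {i j : ℕ} : sf w i < sf w j ↔
    ∃ l, (∀ m < l, w (i + m) = w (j + m)) ∧ w (i + l) < w (j + l) := Iff.rfl

theorem sf_eq_iff {w : ℕ → ℕ} {i j : ℕ} : sf w i = sf w j ↔ ∀ m, w (i + m) = w (j + m) := by
  unfold sf
  rw [toLex_inj, funext_iff]

theorem sf_ne {n : ℕ} {w : ℕ → ℕ} (hw : w ∈ VW n) {i j : ℕ} (hi : 1 ≤ i) (hij : i < j)
    (hj : j ≤ n + 1) : w (i + (n + 1 - j)) ≠ w (j + (n + 1 - j)) := by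
  have h1 := hw (i + (n + 1 - j))
  have h2 := hw (j + (n + 1 - j))
  omega

theorem sf_last {n : ℕ} {w : ℕ → ℕ} (hw : w ∈ VW n) {i : ℕ} (hi : 1 ≤ i) (hin : i ≤ n) :
    sf w (n + 1) < sf w i := by
  rw [sf_lt_iff]
  refine ⟨0, by omega, ?_⟩
  have h1 := hw i
  have h2 := hw (n + 1)
  simp only [add_zero]
  omega

/-- Next smaller suffix. -/
noncomputable def nss (w : ℕ → ℕ) (i : ℕ) : ℕ := sInf {j | i < j ∧ sf w j < sf w i}

theorem nss_eq {w : ℕ → ℕ} {i j : ℕ} (hij : i < j) (h1 : sf w j < sf w i)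
    (h2 : ∀ l, i < l → l < j → sf w i < sf w l) : nss w i = j := by
  have hm : j ∈ {j | i < j ∧ sf w j < sf w i} := ⟨hij, h1⟩
  apply le_antisymm (Nat.sInf_le hm)
  by_contra hlt
  push Not at hlt
  have := Nat.sInf_mem (⟨j, hm⟩ : Set.Nonempty {j | i < j ∧ sf w j < sf w i})
  exact lt_asymm this.2 (h2 _ this.1 hlt)

theorem nss_spec {n : ℕ} {w : ℕ → ℕ} (hw : w ∈ VW n) {i : ℕ} (hi : 1 ≤ i) (hin : i ≤ n) :
    i < nss w i ∧ nss w i ≤ n + 1 ∧ sf w (nss w i) < sf w i ∧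
      ∀ l, i < l → l < nss w i → sf w i < sf w l := by
  have hm : (n + 1) ∈ {j | i < j ∧ sf w j < sf w i} := ⟨by omega, sf_last hw hi hin⟩
  have hs := Nat.sInf_mem (⟨_, hm⟩ : Set.Nonempty {j | i < j ∧ sf w j < sf w i})
  have hle : nss w i ≤ n + 1 := Nat.sInf_le hm
  refine ⟨hs.1, hle, hs.2, fun l h1 h2 => ?_⟩
  rcases lt_trichotomy (sf w i) (sf w l) with h | h | h
  · exact h
  · exact absurd (sf_eq_iff.1 h (n + 1 - l)) (sf_ne hw hi h1 (by omega))
  · have : nss w i ≤ l := Nat.sInf_le (show l ∈ {j | i < j ∧ sf w j < sf w i} from ⟨h1, h⟩)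
    omega

theorem Solv.sufcmp {β : Type} {F : (ℕ → ℕ) → β} {S : Set (ℕ → ℕ)} {k : (ℕ → ℕ) → ℕ} {n : ℕ}
    (hS : S ⊆ VW n) {i j : ℕ} (hi : 1 ≤ i) (hij : i < j) (hj : j ≤ n + 1)
    (hk : ∀ w ∈ S, 1 ≤ k w)
    (hlt : Solv F {w | w ∈ S ∧ sf w i < sf w j} (fun w => k w - 1))
    (hgt : Solv F {w | w ∈ S ∧ sf w j < sf w i} (fun w => k w - 1)) : Solv F S k := by
  refine Solv.firstdiff (fun l => i + l) (fun l => j + l) hk (n + 1 - j + 1) ?_ ?_ ?_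
  · intro l _
    exact hlt.mono (fun w hw => ⟨hw.1, sf_lt_iff.2 ⟨l, hw.2⟩⟩) fun w _ => le_rfl
  · intro l _
    exact hgt.mono (fun w hw => ⟨hw.1, sf_lt_iff.2 ⟨l, fun m hm => (hw.2.1 m hm).symm, hw.2.2⟩⟩)
      fun w _ => le_rfl
  · refine .done _ _ fun w hw => ?_
    exact absurd (hw.2 (n + 1 - j) (by omega)) (sf_ne (hS hw.1) hi hij hj)

/-- The table of next smaller suffixes of positions in `[m..n]`. -/
noncomputable def tab (n m : ℕ) (w : ℕ → ℕ) : ℕ → ℕ :=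
  fun i => if m ≤ i ∧ i ≤ n then nss w i else 0

open Classical in
/-- Positions that are not minimal so far. -/
noncomputable def setA (n m : ℕ) (w : ℕ → ℕ) : Finset ℕ :=
  (Finset.Icc m n).filter fun k => ∃ l, m ≤ l ∧ l < k ∧ sf w l < sf w k

open Classical in
/-- Positions charged when processing `i` from `j` onwards. -/
noncomputable def setB (n i j : ℕ) (w : ℕ → ℕ) : Finset ℕ :=
  (Finset.Icc j n).filter fun k => sf w i < sf w k ∧ ∀ l, i < l → l < k → sf w k < sf w l

theorem inner (n i : ℕ) (hi : 1 ≤ i) (hin : i ≤ n) (d : ℕ) : ∀ (j : ℕ) (S : Set (ℕ → ℕ)),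
    n + 1 - j ≤ d → i < j → j ≤ n + 1 → S ⊆ VW n →
    (∀ w ∈ S, ∀ w' ∈ S, tab n (i + 1) w = tab n (i + 1) w') →
    (∀ w ∈ S, ∀ l, i < l → l < j → sf w i < sf w l ∧ sf w j < sf w l) →
    Solv (tab n i) S (fun w => 1 + (setB n i j w).card) := by
  induction d with
  | zero =>
    intro j S hd hij hj hS hT hinv
    obtain rfl : j = n + 1 := by omega
    refine .done _ _ fun w hw w' hw' => ?_
    have e : ∀ w ∈ S, nss w i = n + 1 := fun w hw =>
      nss_eq hij (sf_last (hS hw) hi hin) fun l h1 h2 => (hinv w hw l h1 h2).1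
    funext x
    have := congrFun (hT w hw w' hw') x
    unfold tab at this ⊢
    by_cases hx : x = i
    · subst hx; rw [e w hw, e w' hw']
    · by_cases hx2 : i ≤ x ∧ x ≤ n
      · rw [if_pos (by omega), if_pos (by omega)] at this ⊢; exact this
      · rw [if_neg hx2, if_neg hx2]
  | succ d ih =>
    intro j S hd hij hj hS hT hinv
    refine Solv.sufcmp hS hi hij hj (fun w _ => Nat.le_add_right _ _) ?_ ?_
    · by_cases hne : ∃ w0, w0 ∈ {w | w ∈ S ∧ sf w i < sf w j}
      · obtain ⟨w0, hw0⟩ := hne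
        have hjn : j ≤ n := by
          by_contra hc
          obtain rfl : j = n + 1 := by omega
          exact lt_asymm hw0.2 (sf_last (hS hw0.1) hi hin)
        have hconst : ∀ w ∈ S, nss w j = nss w0 j := by
          intro w hw
          have := congrFun (hT w hw w0 hw0.1) j
          unfold tab at this
          rwa [if_pos (by omega), if_pos (by omega)] at this
        have sp := nss_spec (hS hw0.1) (i := j) (by omega) hjn
        refine (ih (nss w0 j) {w | w ∈ S ∧ sf w i < sf w j} (by omega) (by omega) sp.2.1
          (fun w hw => hS hw.1) (fun w hw w' hw' => hT w hw.1 w' hw'.1) ?_).mono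
          (fun w hw => hw) ?_
        · intro w hw l h1 h2
          have sp' := nss_spec (hS hw.1) (i := j) (by omega) hjn
          rw [hconst w hw.1] at sp'
          rcases lt_trichotomy l j with h | h | h
          · have := hinv w hw.1 l h1 h
            exact ⟨this.1, sp'.2.2.1.trans this.2⟩
          · subst h; exact ⟨hw.2, sp'.2.2.1⟩
          · have := sp'.2.2.2 l h h2
            exact ⟨hw.2.trans this, sp'.2.2.1.trans this⟩
        · intro w hw
          have hsub : insert j (setB n i (nss w0 j) w) ⊆ setB n i j w := by
            intro x hx
            rcases Finset.mem_insert.1 hx with h | h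
            · subst h
              simp only [setB, Finset.mem_filter, Finset.mem_Icc]
              exact ⟨⟨le_rfl, hjn⟩, hw.2, fun l h1 h2 => (hinv w hw.1 l h1 h2).2⟩
            · simp only [setB, Finset.mem_filter, Finset.mem_Icc] at h ⊢
              exact ⟨⟨by omega, h.1.2⟩, h.2⟩
          have hnot : j ∉ setB n i (nss w0 j) w := by
            simp only [setB, Finset.mem_filter, Finset.mem_Icc]
            omega
          have := Finset.card_le_card hsub
          rw [Finset.card_insert_of_notMem hnot] at this
          omega
      · push Not at hne
        exact .done _ _ fun w hw => absurd hw (hne w)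
    · refine .done _ _ fun w hw w' hw' => ?_
      have e : ∀ w ∈ {w | w ∈ S ∧ sf w j < sf w i}, nss w i = j := fun w hw =>
        nss_eq hij hw.2 fun l h1 h2 => (hinv w hw.1 l h1 h2).1
      funext x
      have := congrFun (hT w hw.1 w' hw'.1) x
      unfold tab at this ⊢
      by_cases hx : x = i
      · subst hx; rw [e w hw, e w' hw']
      · by_cases hx2 : i ≤ x ∧ x ≤ n
        · rw [if_pos (by omega), if_pos (by omega)] at this ⊢; exact this
        · rw [if_neg hx2, if_neg hx2]

theorem solv_tab_aux (n d : ℕ) (hd : d ≤ n) :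
    Solv (tab n (n + 1 - d)) (VW n) (fun w => d + (setA n (n + 1 - d) w).card) := by
  induction d with
  | zero =>
    refine .done _ _ fun w _ w' _ => ?_
    funext x
    unfold tab
    rw [if_neg (by omega), if_neg (by omega)]
  | succ d ih =>
    have h := ih (by omega)
    obtain ⟨i, hi⟩ : ∃ i, i = n + 1 - (d + 1) := ⟨_, rfl⟩
    have e : n + 1 - d = i + 1 := by omega
    rw [e] at h
    rw [← hi]
    refine (h.bind (G := tab n i) (k' := fun w => 1 + (setB n i (i + 1) w).card) fun T => ?_).mono
      (fun w hw => hw) ?_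
    · refine inner n i (by omega) (by omega) n (i + 1) _ (by omega) (by omega) (by omega)
        (fun w hw => hw.1) (fun w hw w' hw' => hw.2.trans hw'.2.symm) ?_
      intro w _ l h1 h2
      omega
    · intro w _
      have hdisj : Disjoint (setA n (i + 1) w) (setB n i (i + 1) w) := by
        rw [Finset.disjoint_left]
        intro x hx hx'
        simp only [setA, setB, Finset.mem_filter, Finset.mem_Icc] at hx hx'
        obtain ⟨l, h1, h2, h3⟩ := hx.2
        exact lt_asymm h3 (hx'.2.2 l (by omega) h2)
      have hsub : setA n (i + 1) w ∪ setB n i (i + 1) w ⊆ setA n i w := by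
        intro x hx
        rcases Finset.mem_union.1 hx with hx | hx
        · simp only [setA, Finset.mem_filter, Finset.mem_Icc] at hx ⊢
          obtain ⟨l, h1, h2, h3⟩ := hx.2
          exact ⟨by omega, l, by omega, h2, h3⟩
        · simp only [setA, setB, Finset.mem_filter, Finset.mem_Icc] at hx ⊢
          exact ⟨by omega, i, le_rfl, by omega, hx.2.1⟩
      have := Finset.card_le_card hsub
      rw [Finset.card_union_of_disjoint hdisj] at this
      omega

theorem solv_tab (n : ℕ) : Solv (tab n 1) (VW n) (fun _ => 2 * n) := by
  have h := solv_tab_aux n n le_rfl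
  have e : n + 1 - n = 1 := by omega
  rw [e] at h
  refine h.mono (fun w hw => hw) fun w _ => ?_
  have : (setA n 1 w).card ≤ (Finset.Icc 1 n).card := by
    classical
    unfold setA
    exact Finset.card_le_card (Finset.filter_subset _ _)
  rw [Nat.card_Icc] at this
  omega

/-! ## Lyndon roots -/

theorem lyndon_root {W : ℕ → ℕ} {i j p : ℕ} (hp : 1 ≤ p)
    (hlen : i + 2 * p ≤ j + 1)
    (hper : ∀ k, i ≤ k → k + p ≤ j → W (k + p) = W k)
    (hprim : ∀ q, 1 ≤ q → q < p → ¬ ∀ k, i ≤ k → k + q ≤ j → W (k + q) = W k)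
    (hend : W (j + 1) < W (j + 1 - p)) :
    ∃ s, i ≤ s ∧ s < i + p ∧ nss W s = s + p := by
  obtain ⟨U, hU⟩ : ∃ U : ℕ → ℕ, U = fun x => W (i + x % p) := ⟨_, rfl⟩
  have hUp : ∀ x, U (x + p) = U x := by intro x; rw [hU]; simp
  have hUW : ∀ x, i + x ≤ j → U x = W (i + x) := by
    intro x
    induction x using Nat.strong_induction_on with
    | _ x ih =>
      intro hx
      by_cases hxp : x < p
      · rw [hU]; simp only [Nat.mod_eq_of_lt hxp]
      · have h1 := ih (x - p) (by omega) (by omega)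
        have h2 := hper (i + (x - p)) (by omega) (by omega)
        have h3 := hUp (x - p)
        rw [show x - p + p = x by omega] at h3
        rw [show i + (x - p) + p = i + x by omega] at h2
        rw [h3, h1, h2]
  have hsfp : ∀ x, sf U (x + p) = sf U x := by
    intro x
    rw [sf_eq_iff]
    intro m
    rw [show x + p + m = (x + m) + p by ring, hUp]
  obtain ⟨x, hx, hmin⟩ := Finset.exists_min_image (Finset.range p) (sf U)
    ⟨0, Finset.mem_range.2 (by omega)⟩
  rw [Finset.mem_range] at hx
  have hmin' : ∀ y, sf U x ≤ sf U y := by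
    intro y
    induction y using Nat.strong_induction_on with
    | _ y ih =>
      by_cases hy : y < p
      · exact hmin y (Finset.mem_range.2 hy)
      · have := hsfp (y - p)
        rw [show y - p + p = y by omega] at this
        rw [this]
        exact ih _ (by omega)
  have hne : ∀ d, 1 ≤ d → d < p → sf U x < sf U (x + d) := by
    intro d hd1 hd2
    refine lt_of_le_of_ne (hmin' _) fun e => ?_
    rw [sf_eq_iff] at e
    apply hprim d hd1 hd2
    intro k hk1 hk2
    obtain ⟨z, rfl⟩ := Nat.exists_eq_add_of_le hk1
    have h1 := e (z + p - x)
    rw [show x + (z + p - x) = z + p by omega,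
      show x + d + (z + p - x) = z + d + p by omega, hUp, hUp, hUW z (by omega),
      hUW (z + d) (by omega)] at h1
    rw [show i + z + d = i + (z + d) by ring]
    exact h1.symm
  refine ⟨i + x, by omega, by omega, ?_⟩
  apply nss_eq (by omega)
  · rw [sf_lt_iff]
    refine ⟨j + 1 - p - i - x, fun m hm => ?_, ?_⟩
    · have := hper (i + x + m) (by omega) (by omega)
      rw [show i + x + p + m = i + x + m + p by ring, this]
    · rw [show i + x + p + (j + 1 - p - i - x) = j + 1 by omega,
        show i + x + (j + 1 - p - i - x) = j + 1 - p by omega]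
      exact hend
  · intro l hl1 hl2
    obtain ⟨d, rfl⟩ := Nat.exists_eq_add_of_le hl1.le
    have hlt := hne d (by omega) (by omega)
    rw [sf_lt_iff] at hlt
    obtain ⟨l, h1, h2⟩ := hlt
    have hl : l < p - d := by
      by_contra hc
      have hlt2 : sf U (x + (p - d)) < sf U x := by
        rw [sf_lt_iff]
        refine ⟨l - (p - d), fun m hm => ?_, ?_⟩
        · have := h1 (p - d + m) (by omega)
          rw [show x + d + (p - d + m) = x + m + p by omega, hUp] at this
          rw [← this]; congr 1; ring
        · rw [show x + d + l = x + (l - (p - d)) + p by omega, hUp] at h2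
          rwa [show x + (p - d) + (l - (p - d)) = x + l by omega]
      exact absurd (hmin' (x + (p - d))) (not_le.2 hlt2)
    rw [sf_lt_iff]
    refine ⟨l, fun m hm => ?_, ?_⟩
    · have := h1 m hm
      rw [hUW _ (by omega), hUW _ (by omega)] at this
      rw [show i + x + m = i + (x + m) by ring, this]; congr 1; ring
    · rw [hUW _ (by omega), hUW _ (by omega)] at h2
      rw [show i + x + l = i + (x + l) by ring, show i + x + d + l = i + (x + d + l) by ring]
      exact h2

/-! ## Runs of words -/

/-- `[i..j]` is a maximal `p`-periodic segment of length at least `2p`. -/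
def MaxPer (w : ℕ → ℕ) (n i j p : ℕ) : Prop :=
  1 ≤ p ∧ 1 ≤ i ∧ i + 2 * p ≤ j + 1 ∧ j ≤ n ∧
  (∀ k, i ≤ k → k + p ≤ j → w (k + p) = w k) ∧
  w (i - 1 + p) ≠ w (i - 1) ∧ w (j + 1) ≠ w (j + 1 - p)

/-- `[i..j]` is a run with minimal period `p`. -/
def RunW (w : ℕ → ℕ) (n i j p : ℕ) : Prop :=
  MaxPer w n i j p ∧ ∀ q, 1 ≤ q → q < p → ¬ ∀ k, i ≤ k → k + q ≤ j → w (k + q) = w k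

theorem RunW.root {w : ℕ → ℕ} {n i j p : ℕ} (hw : w ∈ VW n) (h : RunW w n i j p) :
    ∃ s, i ≤ s ∧ s < i + p ∧ (nss w s = s + p ∨ nss (dualW n w) s = s + p) := by
  obtain ⟨⟨hp, hi, hlen, hj, hper, -, hend⟩, hprim⟩ := h
  by_cases hlt : w (j + 1) < w (j + 1 - p)
  · obtain ⟨s, h1, h2, h3⟩ := lyndon_root hp hlen hper hprim hlt
    exact ⟨s, h1, h2, Or.inl h3⟩
  · have a := hw (j + 1)
    have b := hw (j + 1 - p)
    obtain ⟨s, h1, h2, h3⟩ := lyndon_root (W := dualW n w) hp hlen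
      (fun k h1 h2 => (dualW_eq hw _ _).2 (hper k h1 h2))
      (fun q h1 h2 h => hprim q h1 h2 fun k h3 h4 => (dualW_eq hw _ _).1 (h k h3 h4))
      ((dualW_lt hw _ _ (by omega) (by omega)).2 (by omega))
    exact ⟨s, h1, h2, Or.inr h3⟩

/-- Right extension length. -/
noncomputable def rx (w : ℕ → ℕ) (s e : ℕ) : ℕ := sInf {l | w (s + l) ≠ w (e + l)}
/-- Left extension length. -/
noncomputable def lx (w : ℕ → ℕ) (s e : ℕ) : ℕ := sInf {l | w (s - 1 - l) ≠ w (e - 1 - l)}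

theorem sInf_first {P : ℕ → Prop} {l : ℕ} (h1 : ∀ m < l, ¬ P m) (h2 : P l) :
    sInf {l | P l} = l := by
  apply le_antisymm (Nat.sInf_le h2)
  by_contra hlt
  push Not at hlt
  exact h1 _ hlt (Nat.sInf_mem (⟨l, h2⟩ : Set.Nonempty {l | P l}))

theorem sInf_first' {P : ℕ → Prop} {l : ℕ} (hne : ∃ l, P l) (h : sInf {l | P l} = l) :
    (∀ m < l, ¬ P m) ∧ P l := by
  have h1 : P (sInf {l | P l}) := Nat.sInf_mem (s := {l | P l}) hne
  rw [h] at h1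
  refine ⟨fun m hm hP => ?_, h1⟩
  have : sInf {l | P l} ≤ m := Nat.sInf_le hP
  omega

theorem rx_ex {w : ℕ → ℕ} {n s e : ℕ} (hw : w ∈ VW n) (hs : 1 ≤ s) (hse : s < e)
    (he : e ≤ n + 1) : ∃ l < n + 1, w (s + l) ≠ w (e + l) :=
  ⟨n + 1 - e, by omega, sf_ne hw hs hse he⟩

theorem lx_ex {w : ℕ → ℕ} {n s e : ℕ} (hw : w ∈ VW n) (hs : 1 ≤ s) (hse : s < e)
    (he : e ≤ n + 1) : ∃ l < n + 1, w (s - 1 - l) ≠ w (e - 1 - l) := by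
  refine ⟨s - 1, by omega, ?_⟩
  have a := hw (s - 1 - (s - 1))
  have b := hw (e - 1 - (s - 1))
  omega

theorem MaxPer.transfer {w w' : ℕ → ℕ} {n i j p s : ℕ} (hw' : w' ∈ VW n)
    (h : MaxPer w n i j p) (h1 : i ≤ s) (h2 : s < i + p)
    (hr : rx w s (s + p) = rx w' s (s + p)) (hl : lx w s (s + p) = lx w' s (s + p)) :
    MaxPer w' n i j p := by
  obtain ⟨hp, hi, hlen, hj, hper, hbeg, hend⟩ := h
  have e1 : rx w s (s + p) = j + 1 - p - s := by
    apply sInf_first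
    · intro m hm hne
      apply hne
      have := hper (s + m) (by omega) (by omega)
      rw [show s + p + m = s + m + p by ring, this]
    · rw [show s + (j + 1 - p - s) = j + 1 - p by omega,
        show s + p + (j + 1 - p - s) = j + 1 by omega]
      exact hend.symm
  have e2 : lx w s (s + p) = s - i := by
    apply sInf_first
    · intro m hm hne
      apply hne
      have := hper (s - 1 - m) (by omega) (by omega)
      rw [show s + p - 1 - m = s - 1 - m + p by omega, this]
    · rw [show s - 1 - (s - i) = i - 1 by omega, show s + p - 1 - (s - i) = i - 1 + p by omega]
      exact hbeg.symm
  rw [e1] at hr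
  rw [e2] at hl
  obtain ⟨l, -, hle⟩ := rx_ex hw' (s := s) (e := s + p) (by omega) (by omega) (by omega)
  obtain ⟨l', -, hle'⟩ := lx_ex hw' (s := s) (e := s + p) (by omega) (by omega) (by omega)
  obtain ⟨r1, r2⟩ := sInf_first' (P := fun l => w' (s + l) ≠ w' (s + p + l)) ⟨l, hle⟩ hr.symm
  obtain ⟨l1, l2⟩ := sInf_first' (P := fun l => w' (s - 1 - l) ≠ w' (s + p - 1 - l))
    ⟨l', hle'⟩ hl.symm
  refine ⟨hp, hi, hlen, hj, ?_, ?_, ?_⟩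
  · intro k hk1 hk2
    by_cases hks : s ≤ k
    · have := not_not.1 (r1 (k - s) (by omega))
      rw [show s + (k - s) = k by omega, show s + p + (k - s) = k + p by omega] at this
      exact this.symm
    · have := not_not.1 (l1 (s - 1 - k) (by omega))
      rw [show s - 1 - (s - 1 - k) = k by omega,
        show s + p - 1 - (s - 1 - k) = k + p by omega] at this
      exact this.symm
  · rw [show s - 1 - (s - i) = i - 1 by omega,
      show s + p - 1 - (s - i) = i - 1 + p by omega] at l2
    exact l2.symm
  · rw [show s + (j + 1 - p - s) = j + 1 - p by omega,
      show s + p + (j + 1 - p - s) = j + 1 by omega] at r2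
    exact r2.symm

/-- Every periodic segment of length at least `2p` extends to a maximal one. -/
theorem exists_maxPer {w : ℕ → ℕ} {n i j p : ℕ} (hw : w ∈ VW n) (hp : 1 ≤ p) (hi : 1 ≤ i)
    (hlen : i + 2 * p ≤ j + 1) (hj : j ≤ n)
    (hper : ∀ k, i ≤ k → k + p ≤ j → w (k + p) = w k) :
    ∃ i' j', i' ≤ i ∧ j ≤ j' ∧ MaxPer w n i' j' p := by
  induction hm : (i + (n - j)) using Nat.strong_induction_on generalizing i j with
  | _ m ih =>
    by_cases hb : w (i - 1 + p) = w (i - 1)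
    · have a := hw (i - 1)
      have b := hw (i - 1 + p)
      have hi1 : 1 < i := by omega
      obtain ⟨i', j', h1, h2, h3⟩ := ih (i - 1 + (n - j)) (by omega) (i := i - 1) (j := j)
        (by omega) (by omega) hj (by
          intro k hk1 hk2
          by_cases hk : k = i - 1
          · rw [hk]; exact hb
          · exact hper k (by omega) hk2) rfl
      exact ⟨i', j', by omega, h2, h3⟩
    · by_cases he : w (j + 1) = w (j + 1 - p)
      · have a := hw (j + 1)
        have b := hw (j + 1 - p)
        obtain ⟨i', j', h1, h2, h3⟩ := ih (i + (n - (j + 1))) (by omega) (i := i) (j := j + 1)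
          hi (by omega) (by omega) (by
            intro k hk1 hk2
            by_cases hk : k + p = j + 1
            · rw [hk, he]; congr 1; omega
            · exact hper k hk1 (by omega)) rfl
        exact ⟨i', j', h1, by omega, h3⟩
      · exact ⟨i, j, le_rfl, le_rfl, hp, hi, hlen, hj, hper, hb, he⟩

theorem RunW.transfer {w w' : ℕ → ℕ} {n : ℕ} (hw' : w' ∈ VW n)
    (h1 : ∀ i j p, RunW w n i j p → MaxPer w' n i j p)
    (h2 : ∀ i j p, RunW w' n i j p → MaxPer w n i j p) {i j p : ℕ} (h : RunW w n i j p) :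
    RunW w' n i j p := by
  have hM := h1 i j p h
  refine ⟨hM, ?_⟩
  intro q
  induction q using Nat.strong_induction_on with
  | _ q ih =>
    intro hq1 hq2 hper
    obtain ⟨-, hi, hlen, hj, -⟩ := hM
    obtain ⟨i', j', hi', hj', hM'⟩ := exists_maxPer hw' hq1 hi (by omega) hj hper
    have hR : RunW w' n i' j' q := by
      refine ⟨hM', fun r hr1 hr2 hrp => ih r hr2 hr1 (by omega) fun k hk1 hk2 => ?_⟩
      exact hrp k (by omega) (by omega)
    have := (h2 _ _ _ hR).2.2.2.2.1
    exact h.2 q hq1 hq2 fun k hk1 hk2 => this k (by omega) (by omega)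

/-- The set of runs. -/
def runSet (n : ℕ) (w : ℕ → ℕ) : Set (ℕ × ℕ) := {x | ∃ p, RunW w n x.1 x.2 p}

theorem solv_runs (n : ℕ) : Solv (runSet n) (VW n) (fun _ => 8 * n) := by
  have ht := solv_tab n
  have ht' := (solv_tab n).dual n
  have ht2 : Solv (fun w => tab n 1 (dualW n w)) (VW n) (fun _ => 2 * n) :=
    ht'.mono (fun w hw => ⟨hw, dualW_mem hw⟩) fun w _ => le_rfl
  refine ((ht.prod ht2).bind (k' := fun _ => 4 * n) fun T => ?_).mono (fun w hw => hw)
    fun w _ => by omega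
  obtain ⟨S, hS⟩ : ∃ S, S = {w | w ∈ VW n ∧ (tab n 1 w, tab n 1 (dualW n w)) = T} := ⟨_, rfl⟩
  rw [← hS]
  have hSV : ∀ w ∈ S, w ∈ VW n := fun w hw => by rw [hS] at hw; exact hw.1
  have hT : ∀ w ∈ S, ∀ s, 1 ≤ s → s ≤ n → nss w s = T.1 s ∧ nss (dualW n w) s = T.2 s := by
    intro w hw s h1 h2
    rw [hS] at hw
    rw [← hw.2]
    simp [tab, h1, h2]
  have hrange : ∀ w ∈ S, ∀ s, 1 ≤ s → s ≤ n → (s < T.1 s ∧ T.1 s ≤ n + 1) ∧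
      (s < T.2 s ∧ T.2 s ≤ n + 1) := by
    intro w hw s h1 h2
    have a := nss_spec (hSV w hw) h1 h2
    have b := nss_spec (dualW_mem (hSV w hw)) h1 h2
    rw [(hT w hw s h1 h2).1] at a
    rw [(hT w hw s h1 h2).2] at b
    exact ⟨⟨a.1, a.2.1⟩, b.1, b.2.1⟩
  have hall := Solv.all (S := S) (c := 4) (f := fun s w =>
    ((rx w (s + 1) (T.1 (s + 1)), lx w (s + 1) (T.1 (s + 1))),
      (rx w (s + 1) (T.2 (s + 1)), lx w (s + 1) (T.2 (s + 1))))) n (by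
    intro s hs
    have hex := fun w hw => hrange w hw (s + 1) (by omega) (by omega)
    have g1 : Solv (fun w => rx w (s + 1) (T.1 (s + 1))) S (fun _ => 1) :=
      Solv.find (fun l => s + 1 + l) (fun l => T.1 (s + 1) + l) (n + 1) fun w hw =>
        rx_ex (hSV w hw) (by omega) (hex w hw).1.1 (hex w hw).1.2
    have g2 : Solv (fun w => lx w (s + 1) (T.1 (s + 1))) S (fun _ => 1) :=
      Solv.find (fun l => s + 1 - 1 - l) (fun l => T.1 (s + 1) - 1 - l) (n + 1) fun w hw =>
        lx_ex (hSV w hw) (by omega) (hex w hw).1.1 (hex w hw).1.2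
    have g3 : Solv (fun w => rx w (s + 1) (T.2 (s + 1))) S (fun _ => 1) :=
      Solv.find (fun l => s + 1 + l) (fun l => T.2 (s + 1) + l) (n + 1) fun w hw =>
        rx_ex (hSV w hw) (by omega) (hex w hw).2.1 (hex w hw).2.2
    have g4 : Solv (fun w => lx w (s + 1) (T.2 (s + 1))) S (fun _ => 1) :=
      Solv.find (fun l => s + 1 - 1 - l) (fun l => T.2 (s + 1) - 1 - l) (n + 1) fun w hw =>
        lx_ex (hSV w hw) (by omega) (hex w hw).2.1 (hex w hw).2.2
    exact (g1.prod g2).prod (g3.prod g4))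
  refine hall.congr ?_
  intro w hw w' hw' heq
  have hent : ∀ s, 1 ≤ s → s ≤ n → (rx w s (T.1 s) = rx w' s (T.1 s) ∧
      lx w s (T.1 s) = lx w' s (T.1 s)) ∧ (rx w s (T.2 s) = rx w' s (T.2 s) ∧
      lx w s (T.2 s) = lx w' s (T.2 s)) := by
    intro s h1 h2
    have := List.map_inj_left.1 heq (s - 1) (List.mem_range.2 (by omega))
    simp only [show s - 1 + 1 = s by omega, Prod.mk.injEq] at this
    exact this
  have key : ∀ w ∈ S, ∀ w' ∈ S, (∀ s, 1 ≤ s → s ≤ n → (rx w s (T.1 s) = rx w' s (T.1 s) ∧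
      lx w s (T.1 s) = lx w' s (T.1 s)) ∧ (rx w s (T.2 s) = rx w' s (T.2 s) ∧
      lx w s (T.2 s) = lx w' s (T.2 s))) → ∀ i j p, RunW w n i j p → MaxPer w' n i j p := by
    intro w hw w' hw' hent i j p hR
    obtain ⟨s, h1, h2, h3⟩ := hR.root (hSV w hw)
    have hM := hR.1
    have hb : 1 ≤ s ∧ s ≤ n := by
      obtain ⟨a1, a2, a3, a4, -⟩ := hM
      omega
    have hTs := hT w hw s hb.1 hb.2
    have he := hent s hb.1 hb.2
    rcases h3 with h3 | h3
    · rw [← hTs.1, h3] at he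
      exact hM.transfer (hSV w' hw') h1 h2 he.1.1 he.1.2
    · rw [← hTs.2, h3] at he
      exact hM.transfer (hSV w' hw') h1 h2 he.2.1 he.2.2
  have k1 := key w hw w' hw' hent
  have k2 := key w' hw' w hw fun s h1 h2 => by
    obtain ⟨⟨a, b⟩, c, d⟩ := hent s h1 h2
    exact ⟨⟨a.symm, b.symm⟩, c.symm, d.symm⟩
  ext x
  constructor
  · rintro ⟨p, hp⟩
    exact ⟨p, RunW.transfer (hSV w' hw') k1 k2 hp⟩
  · rintro ⟨p, hp⟩
    exact ⟨p, RunW.transfer (hSV w hw) k2 k1 hp⟩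

/-! ## Back to strings over arbitrary alphabets -/

open Classical in
/-- Rank word of a string. -/
noncomputable def hat {α : Type} [LinearOrder α] (n : ℕ) (t : ℕ → α) : ℕ → ℕ :=
  fun k => if k = 0 ∨ n < k then 0 else 1 + ((Finset.Icc 1 n).filter fun m => t m < t k).card

theorem hat_mem {α : Type} [LinearOrder α] (n : ℕ) (t : ℕ → α) : hat n t ∈ VW n := by
  intro k
  unfold hat
  split_ifs with h <;> simp [h]

theorem hat_lt {α : Type} [LinearOrder α] (n : ℕ) (t : ℕ → α) {i j : ℕ} (hi : 1 ≤ i ∧ i ≤ n)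
    (hj : 1 ≤ j ∧ j ≤ n) (h : t i < t j) : hat n t i < hat n t j := by
  unfold hat
  rw [if_neg (by omega), if_neg (by omega)]
  apply Nat.add_lt_add_left
  apply Finset.card_lt_card
  rw [Finset.ssubset_iff_of_subset]
  · exact ⟨i, by simp [hi, h], by simp⟩
  · intro x hx
    simp only [Finset.mem_filter] at hx ⊢
    exact ⟨hx.1, hx.2.trans h⟩

theorem hat_eq {α : Type} [LinearOrder α] (n : ℕ) (t : ℕ → α) {i j : ℕ} (hi : 1 ≤ i ∧ i ≤ n)
    (hj : 1 ≤ j ∧ j ≤ n) : hat n t i = hat n t j ↔ t i = t j := by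
  constructor
  · intro h
    rcases lt_trichotomy (t i) (t j) with h' | h' | h'
    · have := hat_lt n t hi hj h'; omega
    · exact h'
    · have := hat_lt n t hj hi h'; omega
  · intro h
    unfold hat
    rw [if_neg (by omega), if_neg (by omega), h]

theorem hat_lt_iff {α : Type} [LinearOrder α] (n : ℕ) (t : ℕ → α) {i j : ℕ} (hi : 1 ≤ i ∧ i ≤ n)
    (hj : 1 ≤ j ∧ j ≤ n) : hat n t i < hat n t j ↔ t i < t j := by
  refine ⟨fun h => ?_, hat_lt n t hi hj⟩
  by_contra hc
  rcases (not_lt.1 hc).lt_or_eq with h' | h'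
  · have := hat_lt n t hj hi h'; omega
  · have := (hat_eq n t hj hi).2 h'; omega

theorem path_hat {α : Type} [LinearOrder α] (n : ℕ) (t : ℕ → α) (T : DecisionTree) (hT : T.WF n) :
    T.path (hat n t) = T.path t := by
  induction T with
  | leaf => rfl
  | node i j l e g h1 h2 h3 =>
    obtain ⟨a, b, c, d, w1, w2, w3⟩ := hT
    simp only [DecisionTree.path, hat_lt_iff n t ⟨a, b⟩ ⟨c, d⟩, hat_eq n t ⟨a, b⟩ ⟨c, d⟩,
      h1 w1, h2 w2, h3 w3]

theorem minPeriod_spec {α : Type} (t : ℕ → α) {i j : ℕ} (hij : i ≤ j) :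
    IsPeriodOf t i j (minPeriod t i j) := by
  have : (j + 1 - i) ∈ {p | IsPeriodOf t i j p} := ⟨by omega, le_rfl, fun k _ _ => by omega⟩
  exact Nat.sInf_mem ⟨_, this⟩

theorem minPeriod_le {α : Type} (t : ℕ → α) {i j p : ℕ} (h : IsPeriodOf t i j p) :
    minPeriod t i j ≤ p := Nat.sInf_le h

theorem isRun_iff {α : Type} [LinearOrder α] (n : ℕ) (t : ℕ → α) (i j : ℕ) :
    IsRun t n i j ↔ ∃ p, RunW (hat n t) n i j p := by
  have hV := hat_mem n t
  constructor
  · rintro ⟨hi, hij, hj, hlen, hl, hr⟩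
    have hs := minPeriod_spec t hij
    have hm := fun p (h : IsPeriodOf t i j p) => minPeriod_le t h
    obtain ⟨p, hp⟩ : ∃ p, p = minPeriod t i j := ⟨_, rfl⟩
    rw [← hp] at hs hm hlen hl hr
    obtain ⟨hp1, hp2, hper⟩ := hs
    refine ⟨p, ⟨hp1, hi, by omega, hj, ?_, ?_, ?_⟩, ?_⟩
    · intro k h1 h2
      exact (hat_eq n t (by omega) (by omega)).2 (hper k h1 h2)
    · intro he
      by_cases hi1 : 1 < i
      · have he' := (hat_eq n t (by omega) (by omega)).1 he
        have := minPeriod_le t (i := i - 1) (j := j) (p := p) ⟨hp1, by omega, fun k h1 h2 => by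
          by_cases hk : k = i - 1
          · rw [hk]; exact he'
          · exact hper k (by omega) h2⟩
        have := hl hi1
        omega
      · have a := hV (i - 1)
        have b := hV (i - 1 + p)
        omega
    · intro he
      by_cases hjn : j < n
      · have he' := (hat_eq n t (by omega) (by omega)).1 he
        have := minPeriod_le t (i := i) (j := j + 1) (p := p) ⟨hp1, by omega, fun k h1 h2 => by
          by_cases hk : k + p = j + 1
          · rw [hk, he']; congr 1; omega
          · exact hper k h1 (by omega)⟩
        have := hr hjn
        omega
      · have a := hV (j + 1)
        have b := hV (j + 1 - p)
        omega
    · intro q hq1 hq2 hq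
      have := hm q ⟨hq1, by omega, fun k h1 h2 =>
        (hat_eq n t (by omega) (by omega)).1 (hq k h1 h2)⟩
      omega
  · rintro ⟨p, ⟨hp1, hi, hlen, hj, hper, hbeg, hend⟩, hprim⟩
    have hP : IsPeriodOf t i j p := ⟨hp1, by omega, fun k h1 h2 =>
      (hat_eq n t (by omega) (by omega)).1 (hper k h1 h2)⟩
    -- any period of a longer segment is at least `p`
    have hge : ∀ i' j' q, i' ≤ i → j ≤ j' → IsPeriodOf t i' j' q → p ≤ q := by
      intro i' j' q h1 h2 hq
      by_contra hc
      refine hprim q hq.1 (by omega) fun k h3 h4 => ?_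
      exact (hat_eq n t (by omega) (by omega)).2 (hq.2.2 k (by omega) (by omega))
    have hmin : minPeriod t i j = p := le_antisymm (minPeriod_le t hP)
      (hge i j _ le_rfl le_rfl (minPeriod_spec t (by omega)))
    refine ⟨hi, by omega, hj, by omega, fun hi1 => ?_, fun hjn => ?_⟩
    · have hs := minPeriod_spec t (i := i - 1) (j := j) (by omega)
      have hg := hge _ _ _ (by omega) le_rfl hs
      rw [hmin]
      refine lt_of_le_of_ne hg fun e => ?_
      rw [← e] at hs
      exact hbeg ((hat_eq n t (by omega) (by omega)).2 (hs.2.2 (i - 1) le_rfl (by omega)))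
    · have hs := minPeriod_spec t (i := i) (j := j + 1) (by omega)
      have hg := hge _ _ _ le_rfl (by omega) hs
      rw [hmin]
      refine lt_of_le_of_ne hg fun e => ?_
      rw [← e] at hs
      have := hs.2.2 (j + 1 - p) (by omega) (by omega)
      rw [show j + 1 - p + p = j + 1 by omega] at this
      exact hend ((hat_eq n t (by omega) (by omega)).2 this)

/-- There is a constant `c` such that for every positive `n` there exists a
decision tree of height at most `c · n` finding all runs in strings of
length `n`. -/
theorem runs_linear_decision_tree :
    ∃ c : ℕ, ∀ n : ℕ, 0 < n →
      ∃ T : DecisionTree, T.WF n ∧ FindsAllRuns n T ∧ T.height ≤ c * n := by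
  refine ⟨9, fun n _ => ?_⟩
  obtain ⟨T, h1, h2, h3⟩ := (solv_runs n).toTree n (fun w hw => hw) id
    (fun w _ i j h => by rw [show i = j from h]) (9 * n)
  refine ⟨T, h1, ?_, h2⟩
  intro α _ t₁ t₂ hp i j
  have hc : ((Finset.Icc 1 n).image id).card = n := by simp
  have := h3 (hat n t₁) (hat_mem n t₁) (hat n t₂) (hat_mem n t₂) (by omega) (by omega)
    (by rw [path_hat n t₁ T h1, path_hat n t₂ T h1, hp])
  rw [isRun_iff, isRun_iff]
  have hx := Set.ext_iff.1 this (i, j)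
  exact hx
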